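/- Let O = {o_1,…,o_r} and V = {v_1,…,v_n} be disjoint sets of labeled vertices and let F : V → (O ∪ V choose r) be a function assigning to each v_j an r-element subset of O ∪ V. There exists an O-rooted labeled r-tree T on O ∪ V with F(v_j) = F_T(v_j) for all j ∈ {1,…,n} if and only if F satisfies: (a) whenever v_{i_1} ∈ F(v_{i_2}), v_{i_2} ∈ F(v_{i_3}), …, v_{i_{j−1}} ∈ F(v_{i_j}) for some indices i_1,…,i_j ∈ {1,…,n}, one has v_{i_j} ∉ F(v_{i_1}); and (b) whenever F(v_j) ≠ O, there is a vertex v_i ∈ F(v_j) with |F(v_j) ∩ F(v_i)| = r − 1. Moreover, when these conditions hold, the r-tree T is unique, and for each j with F(v_j) ≠ O the vertex v_i in (b) is unique. -/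

import Mathlib

/-- The father set of a vertex `v ∈ V` in the graph `G` on `O ⊕ V` under the ordering `ν`
(where `ν j` is the `j`-th vertex of the rearrangement, so `v` occupies position `ν.symm v`):
the set of neighbours of `v` that are roots or vertices occurring earlier in `ν`. -/
def fatherSet {r n : ℕ} (G : SimpleGraph (Fin r ⊕ Fin n)) (ν : Equiv.Perm (Fin n))
    (v : Fin n) : Set (Fin r ⊕ Fin n) :=
  {w | G.Adj (Sum.inr v) w ∧
    ((∃ o : Fin r, w = Sum.inl o) ∨ ∃ u : Fin n, w = Sum.inr u ∧ ν.symm u < ν.symm v)}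

/-- `ν` is a valid rearrangement for `G`: each vertex of `V` is adjacent to exactly `r`
vertices among the roots and the earlier vertices, and these `r` vertices are pairwise
adjacent in `G`. -/
def IsValidRearrangement {r n : ℕ} (G : SimpleGraph (Fin r ⊕ Fin n))
    (ν : Equiv.Perm (Fin n)) : Prop :=
  ∀ v : Fin n, Nat.card (fatherSet G ν v) = r ∧ G.IsClique (fatherSet G ν v)

/-- An `O`-rooted labeled `r`-tree on `O ⊕ V` (with `|O| = r`, `|V| = n`): a graph
admitting a valid rearrangement. -/
def IsORootedRTree {r n : ℕ} (G : SimpleGraph (Fin r ⊕ Fin n)) : Prop :=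
  ∃ ν : Equiv.Perm (Fin n), IsValidRearrangement G ν

/-- Condition (a): whenever `v_{i₁} ∈ F(v_{i₂}), …, v_{i_{j-1}} ∈ F(v_{i_j})`, one has
`v_{i_j} ∉ F(v_{i₁})`. -/
def FatherCondA {r n : ℕ} (F : Fin n → Finset (Fin r ⊕ Fin n)) : Prop :=
  ∀ (j : ℕ) (f : Fin (j + 1) → Fin n),
    (∀ t : Fin j, Sum.inr (f t.castSucc) ∈ F (f t.succ)) →
      Sum.inr (f (Fin.last j)) ∉ F (f 0)

/-- Condition (b): whenever `F(v_j) ≠ O`, there is a vertex `v_i ∈ F(v_j)` with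
`|F(v_j) ∩ F(v_i)| = r - 1`. -/
def FatherCondB {r n : ℕ} (F : Fin n → Finset (Fin r ⊕ Fin n)) : Prop :=
  ∀ j : Fin n, F j ≠ Finset.univ.image Sum.inl →
    ∃ i : Fin n, Sum.inr i ∈ F j ∧ (F j ∩ F i).card = r - 1

theorem aux_chain {r n : ℕ} {F : Fin n → Finset (Fin r ⊕ Fin n)} {u v : Fin n}
    (h : Relation.ReflTransGen (fun a b : Fin n => Sum.inr a ∈ F b) u v) :
    ∃ (j : ℕ) (f : Fin (j + 1) → Fin n), f 0 = u ∧ f (Fin.last j) = v ∧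
      ∀ t : Fin j, Sum.inr (f t.castSucc) ∈ F (f t.succ) := by
  induction h using Relation.ReflTransGen.head_induction_on with
  | refl => exact ⟨0, fun _ => v, rfl, rfl, fun t => t.elim0⟩
  | @head a c hac _ ih =>
    obtain ⟨j, f, h0, hl, hf⟩ := ih
    refine ⟨j + 1, Fin.cons a f, rfl, ?_, ?_⟩
    · rw [← Fin.succ_last, Fin.cons_succ, hl]
    · intro t
      refine Fin.cases ?_ (fun s => ?_) t
      · rw [Fin.castSucc_zero, Fin.cons_zero, Fin.cons_succ, h0]
        exact hac
      · rw [Fin.castSucc_succ, Fin.cons_succ, Fin.cons_succ]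
        exact hf s

theorem aux_order {r n : ℕ} {F : Fin n → Finset (Fin r ⊕ Fin n)} (hA : FatherCondA F) :
    ∃ ν : Equiv.Perm (Fin n), ∀ u v, Sum.inr u ∈ F v → ν.symm u < ν.symm v := by
  classical
  let R : Fin n → Fin n → Prop := fun a b => Sum.inr a ∈ F b
  have irr : ∀ u, ¬ Relation.TransGen R u u := by
    intro u hu
    obtain ⟨w, h1, h2⟩ := Relation.TransGen.tail'_iff.1 hu
    obtain ⟨j, f, h0, hl, hf⟩ := aux_chain h1
    apply hA j f hf
    rw [h0, hl]
    exact h2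
  let h : Fin n → ℕ := fun v => (Finset.univ.filter (fun u => Relation.TransGen R u v)).card
  refine ⟨Tuple.sort h, fun u v huv => ?_⟩
  have hlt : h u < h v := by
    apply Finset.card_lt_card
    rw [Finset.ssubset_iff_of_subset]
    · exact ⟨u, by simpa using Relation.TransGen.single huv, by simpa using irr u⟩
    · intro w hw
      simp only [Finset.mem_filter, Finset.mem_univ, true_and] at hw ⊢
      exact hw.tail huv
  by_contra hc
  have := Tuple.monotone_sort h (not_lt.1 hc)
  simp only [Function.comp, Equiv.apply_symm_apply] at this
  omega

def auxG {r n : ℕ} (F : Fin n → Finset (Fin r ⊕ Fin n)) : SimpleGraph (Fin r ⊕ Fin n) :=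
  SimpleGraph.fromRel (fun x y =>
    (∃ a b : Fin r, x = Sum.inl a ∧ y = Sum.inl b) ∨ ∃ v : Fin n, y = Sum.inr v ∧ x ∈ F v)

theorem aux_eq_image {r n : ℕ} {S : Finset (Fin r ⊕ Fin n)} (hS : S.card = r)
    (h : ∀ u : Fin n, Sum.inr u ∉ S) : S = Finset.univ.image Sum.inl := by
  apply Finset.eq_of_subset_of_card_le
  · intro x hx
    rcases x with a | u
    · simp
    · exact absurd hx (h u)
  · rw [Finset.card_image_of_injective _ Sum.inl_injective, hS]
    simp

theorem aux_irr {r n : ℕ} {F : Fin n → Finset (Fin r ⊕ Fin n)} (hA : FatherCondA F) (u : Fin n) :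
    Sum.inr u ∉ F u := hA 0 (fun _ => u) (fun t => t.elim0)

/-- the key consequence of the intersection condition -/
theorem aux_sub {r n : ℕ} {F : Fin n → Finset (Fin r ⊕ Fin n)} (hF : ∀ j : Fin n, (F j).card = r)
    (hA : FatherCondA F) {i j : Fin n} (hi : Sum.inr i ∈ F j) (hc : (F j ∩ F i).card = r - 1) :
    ∀ x ∈ F j, x ≠ Sum.inr i → x ∈ F i := by
  have h1 : F j ∩ F i = (F j).erase (Sum.inr i) := by
    apply Finset.eq_of_subset_of_card_le
    · intro x hx
      rw [Finset.mem_inter] at hx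
      refine Finset.mem_erase.2 ⟨?_, hx.1⟩
      rintro rfl
      exact aux_irr hA i hx.2
    · rw [Finset.card_erase_of_mem hi, hF, hc]
  intro x hx hne
  have : x ∈ F j ∩ F i := by
    rw [h1]
    exact Finset.mem_erase.2 ⟨hne, hx⟩
  exact (Finset.mem_inter.1 this).2

theorem aux_unique {r n : ℕ} (hn : 0 < n) {F : Fin n → Finset (Fin r ⊕ Fin n)}
    (hF : ∀ j : Fin n, (F j).card = r) {G : SimpleGraph (Fin r ⊕ Fin n)} {ν : Equiv.Perm (Fin n)}
    (hv : IsValidRearrangement G ν) (h : ∀ j : Fin n, fatherSet G ν j = ↑(F j)) :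
    G = auxG F := by
  have hm : ∀ j x, x ∈ F j ↔ x ∈ fatherSet G ν j := fun j x => by rw [h j]; simp
  have hO : F (ν ⟨0, hn⟩) = Finset.univ.image Sum.inl := by
    apply aux_eq_image (hF _)
    intro u hu
    rw [hm] at hu
    rcases hu.2 with ⟨o, ho⟩ | ⟨w, hw, hlt⟩
    · cases ho
    · simp [Fin.lt_def] at hlt
  have hcl := (hv (ν ⟨0, hn⟩)).2
  rw [h, hO] at hcl
  have hll : ∀ a b : Fin r, G.Adj (Sum.inl a) (Sum.inl b) ↔ a ≠ b := by
    intro a b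
    constructor
    · rintro hab rfl
      exact G.loopless.irrefl _ hab
    · intro hab
      exact hcl (by simp) (by simp) (by simpa using hab)
  have hrl : ∀ u a, G.Adj (Sum.inr u) (Sum.inl a) ↔ Sum.inl a ∈ F u := by
    intro u a
    rw [hm]
    simp [fatherSet]
  have hrr : ∀ u v, Sum.inr v ∈ F u ↔ G.Adj (Sum.inr u) (Sum.inr v) ∧ ν.symm v < ν.symm u := by
    intro u v
    rw [hm]
    simp [fatherSet]
  ext x y
  simp only [auxG, SimpleGraph.fromRel_adj]
  rcases x with a | u <;> rcases y with b | v
  · simp [hll]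
  · rw [G.adj_comm, hrl]
    simp
  · rw [hrl]
    simp
  · have h1 := hrr u v
    have h2 := hrr v u
    rw [G.adj_comm] at h2
    constructor
    · intro hadj
      refine ⟨hadj.ne, ?_⟩
      have hne : ν.symm u ≠ ν.symm v := by
        intro he
        exact hadj.ne (by rw [ν.symm.injective he])
      rcases lt_or_gt_of_ne hne with hl | hl
      · exact Or.inl (Or.inr ⟨v, rfl, h2.2 ⟨hadj, hl⟩⟩)
      · exact Or.inr (Or.inr ⟨u, rfl, h1.2 ⟨hadj, hl⟩⟩)
    · rintro ⟨_, (⟨a, b, hab, _⟩ | ⟨w, hw, hm'⟩) | (⟨a, b, hab, _⟩ | ⟨w, hw, hm'⟩)⟩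
      · cases hab
      · cases hw
        exact (h2.1 hm').1
      · cases hab
      · cases hw
        exact (h1.1 hm').1

theorem aux_exists {r n : ℕ} {F : Fin n → Finset (Fin r ⊕ Fin n)}
    (hF : ∀ j : Fin n, (F j).card = r) (hA : FatherCondA F) (hB : FatherCondB F) :
    ∃ ν : Equiv.Perm (Fin n),
      IsValidRearrangement (auxG F) ν ∧ ∀ j : Fin n, fatherSet (auxG F) ν j = ↑(F j) := by
  obtain ⟨ν, hν⟩ := aux_order hA
  have hadj : ∀ v x, x ∈ F v → (auxG F).Adj x (Sum.inr v) := by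
    intro v x hx
    simp only [auxG, SimpleGraph.fromRel_adj]
    refine ⟨?_, Or.inl (Or.inr ⟨v, rfl, hx⟩)⟩
    rintro rfl
    exact aux_irr hA v hx
  have hfs : ∀ j : Fin n, fatherSet (auxG F) ν j = ↑(F j) := by
    intro j
    ext x
    constructor
    · rintro ⟨h1, h2⟩
      simp only [auxG, SimpleGraph.fromRel_adj] at h1
      rcases h1 with ⟨_, (⟨a, b, hab, _⟩ | ⟨w, hw, hm'⟩) | (⟨a, b, _, hab⟩ | ⟨w, hw, hm'⟩)⟩
      · cases hab
      · rcases h2 with ⟨o, ho⟩ | ⟨u, hu, hlt⟩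
        · rw [ho] at hw
          cases hw
        · rw [hu] at hw
          cases hw
          exact absurd (hν _ _ hm') (not_lt.2 hlt.le)
      · cases hab
      · cases hw
        exact hm'
    · intro hx
      have hx' : x ∈ F j := hx
      refine ⟨(hadj j x hx').symm, ?_⟩
      rcases x with a | u
      · exact Or.inl ⟨a, rfl⟩
      · exact Or.inr ⟨u, rfl, hν _ _ hx'⟩
  have hcl : ∀ k : ℕ, ∀ j : Fin n, (ν.symm j).val = k →
      (auxG F).IsClique (↑(F j) : Set (Fin r ⊕ Fin n)) := by
    intro k
    induction k using Nat.strong_induction_on with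
    | _ k ih =>
      intro j hj
      by_cases hO : F j = Finset.univ.image Sum.inl
      · rw [hO]
        intro x hx y hy hxy
        simp only [Finset.coe_image, Finset.coe_univ, Set.image_univ, Set.mem_range] at hx hy
        obtain ⟨a, rfl⟩ := hx
        obtain ⟨b, rfl⟩ := hy
        simp only [auxG, SimpleGraph.fromRel_adj]
        exact ⟨hxy, Or.inl (Or.inl ⟨a, b, rfl, rfl⟩)⟩
      · obtain ⟨i, hi, hc⟩ := hB j hO
        have hs := aux_sub hF hA hi hc
        have hlt := hν _ _ hi
        have hci := ih (ν.symm i).val (by rw [← hj]; exact hlt) i rfl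
        intro x hx y hy hxy
        by_cases hxi : x = Sum.inr i
        · subst hxi
          exact (hadj i y (hs y hy hxy.symm)).symm
        · by_cases hyi : y = Sum.inr i
          · subst hyi
            exact hadj i x (hs x hx hxy)
          · exact hci (hs x hx hxi) (hs y hy hyi) hxy
  refine ⟨ν, fun v => ?_, hfs⟩
  rw [hfs]
  refine ⟨?_, hcl _ v rfl⟩
  simpa using hF v

theorem aux_forward {r n : ℕ} {F : Fin n → Finset (Fin r ⊕ Fin n)}
    (hF : ∀ j : Fin n, (F j).card = r) {G : SimpleGraph (Fin r ⊕ Fin n)} {ν : Equiv.Perm (Fin n)}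
    (hv : IsValidRearrangement G ν) (h : ∀ j : Fin n, fatherSet G ν j = ↑(F j)) :
    FatherCondA F ∧ FatherCondB F := by
  have hm : ∀ j x, x ∈ F j ↔ x ∈ fatherSet G ν j := fun j x => by rw [h j]; simp
  have hrr : ∀ u v, Sum.inr v ∈ F u ↔ G.Adj (Sum.inr u) (Sum.inr v) ∧ ν.symm v < ν.symm u := by
    intro u v
    rw [hm]
    simp [fatherSet]
  have hA : FatherCondA F := by
    intro j f hf hl
    have key : ∀ t : Fin (j + 1), ν.symm (f 0) ≤ ν.symm (f t) := by
      intro t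
      induction t using Fin.induction with
      | zero => exact le_rfl
      | succ t ih => exact ih.trans ((hrr _ _).1 (hf t)).2.le
    exact absurd ((hrr _ _).1 hl).2 (not_lt.2 (key _))
  refine ⟨hA, ?_⟩
  intro j hj
  have hne : (Finset.univ.filter (fun u : Fin n => Sum.inr u ∈ F j)).Nonempty := by
    by_contra hc
    rw [Finset.not_nonempty_iff_eq_empty] at hc
    apply hj
    apply aux_eq_image (hF j)
    intro u hu
    have : u ∈ Finset.univ.filter (fun u : Fin n => Sum.inr u ∈ F j) := by simpa using hu
    rw [hc] at this
    simp at this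
  obtain ⟨i, hi, hmax⟩ := Finset.exists_max_image _ (fun u => ν.symm u) hne
  simp only [Finset.mem_filter, Finset.mem_univ, true_and] at hi hmax
  refine ⟨i, hi, ?_⟩
  have hcl := (hv j).2
  rw [h] at hcl
  have : F j ∩ F i = (F j).erase (Sum.inr i) := by
    ext x
    rw [Finset.mem_inter, Finset.mem_erase]
    constructor
    · rintro ⟨h1, h2⟩
      refine ⟨?_, h1⟩
      rintro rfl
      exact aux_irr hA i h2
    · rintro ⟨h1, h2⟩
      refine ⟨h2, ?_⟩
      rw [hm]
      refine ⟨hcl hi h2 h1.symm, ?_⟩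
      rcases x with a | u
      · exact Or.inl ⟨a, rfl⟩
      · refine Or.inr ⟨u, rfl, lt_of_le_of_ne (hmax u h2) ?_⟩
        intro he
        exact h1 (by rw [ν.symm.injective he])
  rw [this, Finset.card_erase_of_mem hi, hF]

/-- A function `F` assigning to each vertex of `V` an `r`-element subset of `O ∪ V` is the
family of father sets of an `O`-rooted labeled `r`-tree if and only if it satisfies
conditions (a) and (b); moreover, in that case the `r`-tree is unique, and the vertex
`v_i` in condition (b) is unique. -/
theorem father_function_characterization (r n : ℕ) (hr : 0 < r) (hn : 0 < n)
    (F : Fin n → Finset (Fin r ⊕ Fin n)) (hF : ∀ j : Fin n, (F j).card = r) :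
    ((∃ (G : SimpleGraph (Fin r ⊕ Fin n)) (ν : Equiv.Perm (Fin n)),
        IsValidRearrangement G ν ∧ ∀ j : Fin n, fatherSet G ν j = ↑(F j)) ↔
      FatherCondA F ∧ FatherCondB F) ∧
    (FatherCondA F → FatherCondB F →
      (∃! G : SimpleGraph (Fin r ⊕ Fin n), ∃ ν : Equiv.Perm (Fin n),
          IsValidRearrangement G ν ∧ ∀ j : Fin n, fatherSet G ν j = ↑(F j)) ∧
      ∀ j : Fin n, F j ≠ Finset.univ.image Sum.inl →
        ∃! i : Fin n, Sum.inr i ∈ F j ∧ (F j ∩ F i).card = r - 1) := by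
  refine ⟨⟨?_, ?_⟩, ?_⟩
  · rintro ⟨G, ν, hv, h⟩
    exact aux_forward hF hv h
  · rintro ⟨hA, hB⟩
    exact ⟨auxG F, aux_exists hF hA hB⟩
  · intro hA hB
    refine ⟨⟨auxG F, aux_exists hF hA hB, ?_⟩, ?_⟩
    · rintro G ⟨ν, hv, h⟩
      exact aux_unique hn hF hv h
    · intro j hj
      obtain ⟨i, hi, hc⟩ := hB j hj
      refine ⟨i, ⟨hi, hc⟩, ?_⟩
      rintro k ⟨hk, hck⟩
      by_contra hne
      have h1 := aux_sub hF hA hi hc (Sum.inr k) hk (by simpa using hne)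
      have h2 := aux_sub hF hA hk hck (Sum.inr i) hi (by simpa using Ne.symm hne)
      obtain ⟨ν, hν⟩ := aux_order hA
      exact absurd (hν _ _ h1) (not_lt.2 (hν _ _ h2).le)
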